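/- arXiv:1710.07343 — 2 statements merged into one kernel-verified Lean document; each statement's English description precedes it below -/
import Mathlib

section
/- Let (J_A,a) be a partial m₁×n₁ matrix and (J_B,b) a partial m₂×n₂ matrix over a field 𝔽. Their direct sum (J_A,a) ⊕ (J_B,b) is the partial (m₁+m₂)×(n₁+n₂) matrix with pattern {(i,j) : (i,j) ∈ J_A} ∪ {(m₁+i, n₁+j) : (i,j) ∈ J_B} and the corresponding entries (all other positions unspecified). Then fmr((J_A,a) ⊕ (J_B,b)) = max{fmr(J_A,a), fmr(J_B,b)}. -/
open Matrix

variable {F : Type*} [Field F] {m n : Type*} [Fintype m] [Fintype n]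

/-- `B` is a completion of the partial matrix `(J, a)`: it agrees with the
prescribed entries on the pattern `J`. -/
def Completes (J : Set (m × n)) (a : m → n → F) (B : Matrix m n F) : Prop :=
  ∀ p ∈ J, B p.1 p.2 = a p.1 p.2

/-- Minimal rank of the partial matrix `(J, a)`: the minimum of the ranks of
all completions. -/
noncomputable def pmr (J : Set (m × n)) (a : m → n → F) : ℕ :=
  sInf {r : ℕ | ∃ B : Matrix m n F, Completes J a B ∧ B.rank = r}

/-- A pattern `T` is triangular if whenever `(i,j) ∈ T` and `(k,l) ∈ T`,
then `(i,l) ∈ T` or `(k,j) ∈ T`. -/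
def Triangular (T : Set (m × n)) : Prop :=
  ∀ p ∈ T, ∀ q ∈ T, (p.1, q.2) ∈ T ∨ (q.1, p.2) ∈ T

/-- Triangular minimal rank: the maximum of `pmr` over triangular
subpatterns of `J`. -/
noncomputable def ptmr (J : Set (m × n)) (a : m → n → F) : ℕ :=
  sSup {r : ℕ | ∃ T ⊆ J, Triangular T ∧ pmr T a = r}

/-- Pattern of the tensor `(J,a) ⊗ I_b`. -/
def TensorJ (J : Set (m × n)) (b : ℕ) : Set ((m × Fin b) × (n × Fin b)) :=
  {p | (p.1.1, p.2.1) ∈ J}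

/-- Entries of the tensor `(J,a) ⊗ I_b`: `a i j` on the diagonal of each
`b × b` block, `0` off the diagonal. -/
def TensorA (a : m → n → F) (b : ℕ) : m × Fin b → n × Fin b → F :=
  fun ip jq => if ip.2 = jq.2 then a ip.1 jq.1 else 0

/-- `b`-fold minimal rank `mr_b(J,a) = mr((J,a) ⊗ I_b)`. -/
noncomputable def pmrb (J : Set (m × n)) (a : m → n → F) (b : ℕ) : ℕ :=
  pmr (TensorJ J b) (TensorA a b)

/-- Fractional minimal rank: `inf_{b ≥ 1} mr_b(J,a) / b`. -/
noncomputable def pfmr (J : Set (m × n)) (a : m → n → F) : ℝ :=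
  ⨅ b : ℕ+, (pmrb J a b : ℝ) / (b : ℝ)

/-- Pattern of the direct sum of two partial matrices. -/
def DirectSumJ {m₁ n₁ m₂ n₂ : Type*} (JA : Set (m₁ × n₁)) (JB : Set (m₂ × n₂)) :
    Set ((m₁ ⊕ m₂) × (n₁ ⊕ n₂)) :=
  {p | (∃ i j, p = (Sum.inl i, Sum.inl j) ∧ (i, j) ∈ JA) ∨
       (∃ i j, p = (Sum.inr i, Sum.inr j) ∧ (i, j) ∈ JB)}

/-- Entries of the direct sum of two partial matrices (values off the two
diagonal blocks are irrelevant; we use `0`). -/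
def DirectSumA {F : Type*} [Field F] {m₁ n₁ m₂ n₂ : Type*}
    (a : m₁ → n₁ → F) (b : m₂ → n₂ → F) : (m₁ ⊕ m₂) → (n₁ ⊕ n₂) → F :=
  fun r c =>
    match r, c with
    | Sum.inl i, Sum.inl j => a i j
    | Sum.inr i, Sum.inr j => b i j
    | _, _ => 0

theorem Matrix.exists_eq_mul_of_rank_le {m n : Type*} [Fintype n] {A : Matrix m n F}
    {r : ℕ} (h : A.rank ≤ r) :
    ∃ (P : Matrix m (Fin r) F) (Q : Matrix (Fin r) n F), A = P * Q := by
  classical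
  obtain ⟨φ, hφ⟩ := (finrank_le_iff_exists_linearMap (R := F)
    (M := LinearMap.range A.mulVecLin) (M' := Fin r → F)).1 (by rwa [Module.finrank_fin_fun])
  obtain ⟨ψ, hψ⟩ := φ.exists_leftInverse_of_injective (LinearMap.ker_eq_bot.2 hφ)
  refine ⟨LinearMap.toMatrix' ((LinearMap.range A.mulVecLin).subtype ∘ₗ ψ),
    LinearMap.toMatrix' (φ ∘ₗ A.mulVecLin.rangeRestrict), ?_⟩
  rw [← LinearMap.toMatrix'_comp, LinearMap.comp_assoc, ← LinearMap.comp_assoc _ φ ψ, hψ,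
    LinearMap.id_comp, LinearMap.subtype_comp_codRestrict]
  exact (LinearMap.toMatrix'_toLin' A).symm

theorem pmr_le_card {m n ι : Type*} [Fintype n] [Fintype ι] {J : Set (m × n)} {a : m → n → F}
    {P : Matrix m ι F} {Q : Matrix ι n F} (h : Completes J a (P * Q)) :
    pmr J a ≤ Fintype.card ι :=
  le_trans (Nat.sInf_le ⟨P * Q, h, rfl⟩) ((rank_mul_le_left P Q).trans P.rank_le_card_width)

theorem exists_completes_mul_of_pmr_le {m n : Type*} [Fintype n] {J : Set (m × n)}
    {a : m → n → F} {r : ℕ} (h : pmr J a ≤ r) :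
    ∃ (P : Matrix m (Fin r) F) (Q : Matrix (Fin r) n F), Completes J a (P * Q) := by
  obtain ⟨B, hB, hr⟩ := Nat.sInf_mem
    (s := {r : ℕ | ∃ B : Matrix m n F, Completes J a B ∧ B.rank = r})
    ⟨(of a).rank, of a, fun _ _ => rfl, rfl⟩
  obtain ⟨P, Q, rfl⟩ := Matrix.exists_eq_mul_of_rank_le (hr.trans_le h)
  exact ⟨P, Q, hB⟩

theorem pmr_le_of_submatrix {m n m' n' : Type*} [Fintype n] [Fintype n']
    {J : Set (m × n)} {a : m → n → F} {J' : Set (m' × n')} {a' : m' → n' → F}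
    (f : m' → m) (g : n' → n)
    (h : ∀ p ∈ J', (f p.1, g p.2) ∈ J ∧ a (f p.1) (g p.2) = a' p.1 p.2) :
    pmr J' a' ≤ pmr J a := by
  obtain ⟨P, Q, hPQ⟩ := exists_completes_mul_of_pmr_le (le_refl (pmr J a))
  have : Completes J' a' (P.submatrix f id * Q.submatrix id g) := fun p hp =>
    (hPQ _ (h p hp).1).trans (h p hp).2
  simpa using pmr_le_card this

theorem pmrb_mul_le {m n : Type*} [Fintype n] (J : Set (m × n)) (a : m → n → F)
    (k b : ℕ) :
    pmrb J a (k * b) ≤ k * pmrb J a b := by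
  obtain ⟨P, Q, hPQ⟩ := exists_completes_mul_of_pmr_le (le_refl (pmrb J a b))
  let e : Fin (k * b) ≃ Fin k × Fin b := finProdFinEquiv.symm
  let P' : Matrix (m × Fin (k * b)) (Fin k × Fin (pmrb J a b)) F :=
    of fun i s => if (e i.2).1 = s.1 then P (i.1, (e i.2).2) s.2 else 0
  let Q' : Matrix (Fin k × Fin (pmrb J a b)) (n × Fin (k * b)) F :=
    of fun s j => if s.1 = (e j.2).1 then Q s.2 (j.1, (e j.2).2) else 0
  have : Completes (TensorJ J (k * b)) (TensorA a (k * b)) (P' * Q') := by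
    rintro ⟨⟨i, p⟩, ⟨j, q⟩⟩ hij
    have hPQ' := hPQ ((i, (e p).2), (j, (e q).2)) hij
    have hmul : (P' * Q') (i, p) (j, q) =
        if (e p).1 = (e q).1 then (P * Q) (i, (e p).2) (j, (e q).2) else 0 := by
      simp [Matrix.mul_apply, P', Q', Fintype.sum_prod_type, Finset.sum_ite_irrel]
    have heq : p = q ↔ (e p).1 = (e q).1 ∧ (e p).2 = (e q).2 := by
      rw [← Prod.ext_iff, e.apply_eq_iff_eq]
    simp only [TensorA] at hPQ' ⊢
    rw [hmul, hPQ']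
    simp only [heq, ite_and]
  exact (pmr_le_card this).trans (by simp)

theorem pmrb_mul_div_le {m n : Type*} [Fintype n] (J : Set (m × n)) (a : m → n → F)
    (k b : ℕ+) :
    (pmrb J a (k * b) : ℝ) / (k * b : ℝ) ≤ (pmrb J a b : ℝ) / b := by
  have hk : (0 : ℝ) < k := by exact_mod_cast k.pos
  have hb : (0 : ℝ) < b := by exact_mod_cast b.pos
  have h : (pmrb J a (k * b) : ℝ) ≤ k * pmrb J a b := by exact_mod_cast pmrb_mul_le J a k b
  calc (pmrb J a (k * b) : ℝ) / (k * b : ℝ) ≤ (k * pmrb J a b : ℝ) / (k * b : ℝ) := by gcongr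
    _ = (pmrb J a b : ℝ) / b := mul_div_mul_left _ _ hk.ne'

theorem bddBelow_range_pmrb_div {m n : Type*} [Fintype n] (J : Set (m × n)) (a : m → n → F) :
    BddBelow (Set.range fun b : ℕ+ => (pmrb J a b : ℝ) / (b : ℝ)) :=
  ⟨0, by rintro _ ⟨b, rfl⟩; positivity⟩

theorem pfmr_mono {m n m' n' : Type*} [Fintype n] [Fintype n']
    {J : Set (m × n)} {a : m → n → F} {J' : Set (m' × n')} {a' : m' → n' → F}
    (h : ∀ b, pmrb J' a' b ≤ pmrb J a b) : pfmr J' a' ≤ pfmr J a :=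
  ciInf_mono (bddBelow_range_pmrb_div J' a') fun b => by
    have := h b
    gcongr

section DirectSum

variable {m₁ n₁ m₂ n₂ : Type*} [Fintype n₁] [Fintype n₂]
  (JA : Set (m₁ × n₁)) (JB : Set (m₂ × n₂)) (a : m₁ → n₁ → F) (b : m₂ → n₂ → F)

theorem pmrb_le_pmrb_directSum_left (k : ℕ) :
    pmrb JA a k ≤ pmrb (DirectSumJ JA JB) (DirectSumA a b) k :=
  pmr_le_of_submatrix (Prod.map Sum.inl id) (Prod.map Sum.inl id)
    fun p hp => ⟨Or.inl ⟨p.1.1, p.2.1, rfl, hp⟩, rfl⟩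

theorem pmrb_le_pmrb_directSum_right (k : ℕ) :
    pmrb JB b k ≤ pmrb (DirectSumJ JA JB) (DirectSumA a b) k :=
  pmr_le_of_submatrix (Prod.map Sum.inr id) (Prod.map Sum.inr id)
    fun p hp => ⟨Or.inr ⟨p.1.1, p.2.1, rfl, hp⟩, rfl⟩

theorem pmrb_directSum_le (k : ℕ) :
    pmrb (DirectSumJ JA JB) (DirectSumA a b) k ≤ max (pmrb JA a k) (pmrb JB b k) := by
  obtain ⟨P₁, Q₁, h₁⟩ := exists_completes_mul_of_pmr_le (le_max_left (pmrb JA a k) (pmrb JB b k))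
  obtain ⟨P₂, Q₂, h₂⟩ := exists_completes_mul_of_pmr_le (le_max_right (pmrb JA a k) (pmrb JB b k))
  let P : Matrix ((m₁ ⊕ m₂) × Fin k) (Fin (max (pmrb JA a k) (pmrb JB b k))) F :=
    fun i s => Sum.elim (fun x => P₁ (x, i.2) s) (fun x => P₂ (x, i.2) s) i.1
  let Q : Matrix (Fin (max (pmrb JA a k) (pmrb JB b k))) ((n₁ ⊕ n₂) × Fin k) F :=
    fun s j => Sum.elim (fun x => Q₁ s (x, j.2)) (fun x => Q₂ s (x, j.2)) j.1
  have : Completes (TensorJ (DirectSumJ JA JB) k) (TensorA (DirectSumA a b) k) (P * Q) := by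
    rintro ⟨⟨i, p⟩, ⟨j, q⟩⟩ (⟨i', j', he, hij⟩ | ⟨i', j', he, hij⟩)
    · obtain ⟨rfl, rfl⟩ := Prod.mk.inj he
      exact h₁ ((i', p), (j', q)) hij
    · obtain ⟨rfl, rfl⟩ := Prod.mk.inj he
      exact h₂ ((i', p), (j', q)) hij
  exact (pmr_le_card this).trans_eq (Fintype.card_fin _)

theorem pfmr_directSum :
    pfmr (DirectSumJ JA JB) (DirectSumA a b) = max (pfmr JA a) (pfmr JB b) := by
  refine le_antisymm (le_of_forall_gt_imp_ge_of_dense fun c hc => ?_)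
    (max_le (pfmr_mono (pmrb_le_pmrb_directSum_left JA JB a b))
      (pfmr_mono (pmrb_le_pmrb_directSum_right JA JB a b)))
  obtain ⟨k, hk⟩ := exists_lt_of_ciInf_lt ((le_max_left _ _).trans_lt hc)
  obtain ⟨l, hl⟩ := exists_lt_of_ciInf_lt ((le_max_right _ _).trans_lt hc)
  have hA : (pmrb JA a (l * k) : ℝ) / (l * k : ℝ) ≤ c := (pmrb_mul_div_le JA a l k).trans hk.le
  have hB : (pmrb JB b (l * k) : ℝ) / (l * k : ℝ) ≤ c := by
    rw [mul_comm (l : ℕ), mul_comm (l : ℝ)]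
    exact (pmrb_mul_div_le JB b k l).trans hl.le
  refine (ciInf_le (bddBelow_range_pmrb_div _ _) (l * k)).trans ?_
  have hpos : (0 : ℝ) < l * k := by exact_mod_cast (l * k).pos
  rw [div_le_iff₀ hpos] at hA hB
  push_cast
  rw [div_le_iff₀ hpos]
  refine le_trans ?_ (max_le hA hB)
  exact_mod_cast pmrb_directSum_le JA JB a b (l * k)

end DirectSum

/-- `fmr(A ⊕ B) = max{fmr(A), fmr(B)}`. -/
theorem stmt3 {F : Type*} [Field F] (m₁ n₁ m₂ n₂ : ℕ)
    (JA : Set (Fin m₁ × Fin n₁)) (JB : Set (Fin m₂ × Fin n₂))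
    (a : Fin m₁ → Fin n₁ → F) (b : Fin m₂ → Fin n₂ → F) :
    pfmr (DirectSumJ JA JB) (DirectSumA a b) = max (pfmr JA a) (pfmr JB b) :=
  pfmr_directSum JA JB a b
end

section
/- For every partial m×n matrix (J,a) over a field 𝔽, one has tmr(J,a) ≤ fmr(J,a) ≤ mr(J,a). -/
open Matrix

variable {F : Type*} [Field F] {m n : Type*} [Fintype m] [Fintype n]

theorem exists_completes_rank_eq_pmr (J : Set (m × n)) (a : m → n → F) :
    ∃ B : Matrix m n F, Completes J a B ∧ B.rank = pmr J a :=
  Nat.sInf_mem (s := {r : ℕ | ∃ B : Matrix m n F, Completes J a B ∧ B.rank = r})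
    ⟨_, Matrix.of a, fun _ _ => rfl, rfl⟩

theorem pmr_le_rank {J : Set (m × n)} {a : m → n → F} {B : Matrix m n F}
    (hB : Completes J a B) : pmr J a ≤ B.rank :=
  Nat.sInf_le ⟨B, hB, rfl⟩

/-- The columns of a triangular pattern can be listed by decreasing support. -/
theorem Triangular.exists_perm {m : Type*} [Finite m] {n : ℕ} {T : Set (m × Fin n)}
    (hT : Triangular T) :
    ∃ κ : Equiv.Perm (Fin n), ∀ j k, κ k ≤ κ j → ∀ i, (i, j) ∈ T → (i, k) ∈ T := by
  let S : Fin n → Set m := fun j => {i | (i, j) ∈ T}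
  let f : Fin n → ℕᵒᵈ := fun j => OrderDual.toDual (S j).ncard
  refine ⟨(Tuple.sort f).symm, fun j k hkj => ?_⟩
  have hcard : (S j).ncard ≤ (S k).ncard := by
    simpa [f] using Tuple.monotone_sort f hkj
  change S j ⊆ S k
  have hchain : S j ⊆ S k ∨ S k ⊆ S j := by
    by_contra! h
    obtain ⟨⟨i, hij, hik⟩, ⟨l, hlk, hlj⟩⟩ := h.imp Set.not_subset.mp Set.not_subset.mp
    exact (hT _ hij _ hlk).elim hik hlj
  rcases hchain with h | h
  · exact h
  · exact (Set.eq_of_subset_of_ncard_le h hcard).ge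

/-- Column `j` of `(T, a)` is dependent if, on the support of `j`, it is a linear combination of
the columns preceding `j` in the order given by `κ`. -/
def DependentColumn {ι : Type*} [LinearOrder ι] (κ : n → ι) (T : Set (m × n)) (a : m → n → F)
    (j : n) : Prop :=
  ∃ c : n → F, (∀ k, c k ≠ 0 → κ k < κ j) ∧ ∀ i, (i, j) ∈ T → a i j = ∑ k, a i k * c k

section Columns

variable {ι : Type*} [LinearOrder ι] {κ : n → ι} {T : Set (m × n)} {a : m → n → F}

theorem exists_combination_independent_columns [WellFoundedLT ι]
    (hκ : ∀ j k, κ k ≤ κ j → ∀ i, (i, j) ∈ T → (i, k) ∈ T) (j : n) :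
    ∃ c : n → F, (∀ k, c k ≠ 0 → ¬ DependentColumn κ T a k) ∧
      ∀ i, (i, j) ∈ T → a i j = ∑ k, a i k * c k := by
  classical
  induction j using (InvImage.wf κ (wellFounded_lt (α := ι))).induction with
  | _ j ih =>
  by_cases hj : DependentColumn κ T a j
  · obtain ⟨c, hc, hcj⟩ := hj
    have hd : ∀ k, ∃ d : n → F, κ k < κ j → (∀ l, d l ≠ 0 → ¬ DependentColumn κ T a l) ∧
        ∀ i, (i, k) ∈ T → a i k = ∑ l, a i l * d l := by
      intro k
      by_cases hk : κ k < κ j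
      · obtain ⟨d, hd⟩ := ih k hk
        exact ⟨d, fun _ => hd⟩
      · exact ⟨0, fun h => absurd h hk⟩
    choose d hd using hd
    refine ⟨fun l => ∑ k, d k l * c k, fun l hl => ?_, fun i hi => ?_⟩
    · obtain ⟨k, -, hk⟩ := Finset.exists_ne_zero_of_sum_ne_zero hl
      exact (hd k (hc k (right_ne_zero_of_mul hk))).1 l (left_ne_zero_of_mul hk)
    · rw [hcj i hi]
      simp_rw [Finset.mul_sum]
      rw [Finset.sum_comm]
      refine Finset.sum_congr rfl fun k _ => ?_
      by_cases hk : c k = 0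
      · simp [hk]
      · have hlt := hc k hk
        rw [(hd k hlt).2 i (hκ j k hlt.le i hi), Finset.sum_mul]
        simp_rw [mul_assoc]
  · refine ⟨Pi.single j 1, fun k hk => ?_, fun i _ => by simp [Pi.single_apply]⟩
    obtain rfl : k = j := by
      by_contra h
      exact hk (Pi.single_eq_of_ne h 1)
    exact hj

theorem pmr_le_card_independent_columns [WellFoundedLT ι]
    (hκ : ∀ j k, κ k ≤ κ j → ∀ i, (i, j) ∈ T → (i, k) ∈ T) :
    pmr T a ≤ Nat.card {j // ¬ DependentColumn κ T a j} := by
  classical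
  choose c hc hcT using exists_combination_independent_columns (a := a) hκ
  let A : Matrix m {j // ¬ DependentColumn κ T a j} F := Matrix.of fun i k => a i k
  let C : Matrix {j // ¬ DependentColumn κ T a j} n F := Matrix.of fun k j => c j k
  have hAC : Completes T a (A * C) := by
    rintro ⟨i, j⟩ hij
    rw [hcT j i hij, Matrix.mul_apply]
    refine (Fintype.sum_of_injective Subtype.val Subtype.val_injective _ _ (fun k hk => ?_)
      fun _ => rfl)
    have : c j k = 0 := by
      by_contra h
      exact hk ⟨⟨k, hc j k h⟩, rfl⟩
    rw [this, mul_zero]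
  rw [Nat.card_eq_fintype_card]
  exact (pmr_le_rank hAC).trans ((Matrix.rank_mul_le_left A C).trans (Matrix.rank_le_card_width A))

/-- In a completion of `(T, a) ⊗ I_b`, the copies of the columns of `(T, a)` that are not dependent
are linearly independent. -/
theorem linearIndependent_tensor_columns (hinj : Function.Injective κ)
    (hκ : ∀ j k, κ k ≤ κ j → ∀ i, (i, j) ∈ T → (i, k) ∈ T) {b : ℕ}
    {B : Matrix (m × Fin b) (n × Fin b) F} (hB : Completes (TensorJ T b) (TensorA a b) B) :
    LinearIndependent F
      (fun p : {j // ¬ DependentColumn κ T a j} × Fin b => B.col (p.1.1, p.2)) := by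
  classical
  rw [Fintype.linearIndependent_iff]
  intro g hg
  by_contra! hne
  obtain ⟨p, hp, hmax⟩ := Finset.exists_max_image
    (Finset.univ.filter fun p => g p ≠ 0) (fun p => κ p.1.1)
    (by obtain ⟨p, hp⟩ := hne; exact ⟨p, by simpa using hp⟩)
  obtain ⟨⟨j, hj⟩, q⟩ := p
  replace hp : g (⟨j, hj⟩, q) ≠ 0 := by simpa using hp
  replace hmax : ∀ k r, g (k, r) ≠ 0 → κ k.1 ≤ κ j := fun k r hk =>
    hmax (k, r) (by simpa using hk)
  have hrow : ∀ i, (i, j) ∈ T → ∑ k : {j // ¬ DependentColumn κ T a j}, a i k * g (k, q) = 0 := by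
    intro i hi
    have h := congrFun hg (i, q)
    simp only [Finset.sum_apply, Pi.smul_apply, smul_eq_mul, Pi.zero_apply, Matrix.col_apply,
      Fintype.sum_prod_type] at h
    rw [← h]
    refine Finset.sum_congr rfl fun k _ => ?_
    rw [Finset.sum_eq_single q]
    · by_cases hk : g (k, q) = 0
      · simp [hk]
      · rw [hB ((i, q), (k.1, q)) (hκ j k (hmax k q hk) i hi)]
        simp [TensorA, mul_comm]
    · intro r _ hr
      by_cases hk : g (k, r) = 0
      · simp [hk]
      · rw [hB ((i, q), (k.1, r)) (hκ j k (hmax k r hk) i hi)]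
        simp [TensorA, hr.symm]
    · simp
  let c : n → F := fun k =>
    if hk : ¬ DependentColumn κ T a k ∧ k ≠ j then -(g (⟨j, hj⟩, q))⁻¹ * g (⟨k, hk.1⟩, q) else 0
  refine hj ⟨c, fun k hk => ?_, fun i hi => ?_⟩
  · by_cases hkj : ¬ DependentColumn κ T a k ∧ k ≠ j
    · simp only [c, dif_pos hkj] at hk
      exact lt_of_le_of_ne (hmax ⟨k, hkj.1⟩ q (right_ne_zero_of_mul hk)) (hinj.ne hkj.2)
    · simp [c, dif_neg hkj] at hk
  · have hsum : ∑ k, a i k * c k =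
        ∑ k : {j // ¬ DependentColumn κ T a j}, a i k * c k := by
      refine (Fintype.sum_of_injective Subtype.val Subtype.val_injective _ _ (fun k hk => ?_)
        fun _ => rfl).symm
      have hk' : ¬ (¬ DependentColumn κ T a k ∧ k ≠ j) := fun h => hk ⟨⟨k, h.1⟩, rfl⟩
      simp [c, dif_neg hk']
    have hterm : ∀ k : {j // ¬ DependentColumn κ T a j}, a i k * c k =
        (if k = ⟨j, hj⟩ then a i j else 0) + -(g (⟨j, hj⟩, q))⁻¹ * (a i k * g (k, q)) := by
      rintro ⟨k, hk⟩
      by_cases hkj : k = j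
      · subst hkj
        have hck : c k = 0 := dif_neg (by simp)
        rw [hck, if_pos rfl]
        field_simp
        ring
      · have hck : c k = -(g (⟨j, hj⟩, q))⁻¹ * g (⟨k, hk⟩, q) := dif_pos ⟨hk, hkj⟩
        rw [hck, if_neg (by simpa using hkj)]
        ring
    rw [hsum, Finset.sum_congr rfl fun k _ => hterm k, Finset.sum_add_distrib, ← Finset.mul_sum,
      hrow i hi]
    simp

theorem mul_card_independent_columns_le_rank (hinj : Function.Injective κ)
    (hκ : ∀ j k, κ k ≤ κ j → ∀ i, (i, j) ∈ T → (i, k) ∈ T) {b : ℕ}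
    {B : Matrix (m × Fin b) (n × Fin b) F} (hB : Completes (TensorJ T b) (TensorA a b) B) :
    Nat.card {j // ¬ DependentColumn κ T a j} * b ≤ B.rank := by
  classical
  have h := finrank_span_eq_card (linearIndependent_tensor_columns hinj hκ hB)
  rw [Fintype.card_prod, Fintype.card_fin, ← Nat.card_eq_fintype_card] at h
  rw [← h, Matrix.rank_eq_finrank_span_cols]
  exact Submodule.finrank_mono (Submodule.span_mono (Set.range_comp_subset_range
    (fun p : {j // ¬ DependentColumn κ T a j} × Fin b => (p.1.1, p.2)) B.col))

end Columns

theorem Triangular.pmr_mul_le_pmrb {n : ℕ} {J T : Set (m × Fin n)} (hT : Triangular T)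
    (hTJ : T ⊆ J) (a : m → Fin n → F) (b : ℕ) : pmr T a * b ≤ pmrb J a b := by
  obtain ⟨κ, hκ⟩ := hT.exists_perm
  obtain ⟨B, hB, hrank⟩ := exists_completes_rank_eq_pmr (TensorJ J b) (TensorA a b)
  calc pmr T a * b ≤ Nat.card {j // ¬ DependentColumn κ T a j} * b :=
        Nat.mul_le_mul_right b (pmr_le_card_independent_columns hκ)
    _ ≤ B.rank :=
        mul_card_independent_columns_le_rank κ.injective hκ fun p hp => hB p (hTJ hp)
    _ = pmrb J a b := hrank

theorem pmrb_one_le_pmr (J : Set (m × n)) (a : m → n → F) : pmrb J a 1 ≤ pmr J a := by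
  obtain ⟨B, hB, hrank⟩ := exists_completes_rank_eq_pmr J a
  rw [← hrank, ← B.rank_submatrix (Equiv.prodUnique m (Fin 1)) (Equiv.prodUnique n (Fin 1))]
  refine pmr_le_rank fun p hp => ?_
  simpa [TensorA, Subsingleton.elim p.1.2 p.2.2] using hB _ hp

/-- `tmr(J,a) ≤ fmr(J,a) ≤ mr(J,a)`. -/
theorem stmt10 {F : Type*} [Field F] (m n : ℕ)
    (J : Set (Fin m × Fin n)) (a : Fin m → Fin n → F) :
    (ptmr J a : ℝ) ≤ pfmr J a ∧ pfmr J a ≤ (pmr J a : ℝ) := by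
  constructor
  · refine le_ciInf fun b => ?_
    rw [le_div_iff₀ (by exact_mod_cast b.pos)]
    have hmem : ptmr J a ∈ {r : ℕ | ∃ T ⊆ J, Triangular T ∧ pmr T a = r} := by
      refine Nat.sSup_mem ⟨_, ∅, Set.empty_subset J, fun p hp => hp.elim, rfl⟩ ⟨pmrb J a 1, ?_⟩
      rintro _ ⟨T, hTJ, hT, rfl⟩
      simpa using hT.pmr_mul_le_pmrb hTJ a 1
    obtain ⟨T, hTJ, hT, h⟩ := hmem
    rw [← h]
    exact_mod_cast hT.pmr_mul_le_pmrb hTJ a b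
  · calc pfmr J a ≤ (pmrb J a (1 : ℕ+) : ℝ) / ((1 : ℕ+) : ℝ) :=
          ciInf_le ⟨0, by rintro _ ⟨b, rfl⟩; positivity⟩ 1
      _ ≤ pmr J a := by simpa using pmrb_one_le_pmr J a
end
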